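/- Let β_4 > 1 be the real root of x^4 - x - 1. Then β_4 is not a Parry number: the beta expansion d_{β_4}(1-0) of 1 in base β_4 is not eventually periodic. -/

import Mathlib

open Polynomial in
theorem bf_conj (β : ℝ) (hroot : β ^ 4 - β - 1 = 0) (γ : ℂ) (hγ : γ ^ 4 = γ + 1)
    (P : ℤ[X]) (hP : aeval β P = 0) : aeval γ P = 0 := by
  have hirr : Irreducible (X ^ 4 - X - 1 : ℚ[X]) :=
    X_pow_sub_X_sub_one_irreducible_rat (by norm_num)
  have hmon : (X ^ 4 - X - 1 : ℚ[X]).Monic := by monicity!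
  have hmin : (X ^ 4 - X - 1 : ℚ[X]) = minpoly ℚ β :=
    minpoly.eq_of_irreducible_of_monic hirr (by simpa using hroot) hmon
  have h1 : aeval β (P.map (Int.castRingHom ℚ)) = 0 := by
    rw [← hP]; exact aeval_map_algebraMap ℚ β P
  have h2 : (X ^ 4 - X - 1 : ℚ[X]) ∣ P.map (Int.castRingHom ℚ) := by
    rw [hmin]; exact minpoly.dvd ℚ β h1
  obtain ⟨Q, hQ⟩ := h2
  have h3 : aeval γ (P.map (Int.castRingHom ℚ)) = aeval γ P := aeval_map_algebraMap ℚ γ P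
  rw [← h3, hQ, map_mul]
  have : aeval γ (X ^ 4 - X - 1 : ℚ[X]) = 0 := by
    simp; rw [hγ]; ring
  rw [this, zero_mul]

theorem bf_gamma : ∃ γ : ℂ, γ ^ 4 = γ + 1 ∧ 1.06 ≤ ‖γ‖ ∧
    18 < ‖6 - γ - 9 * γ ^ 2 + 5 * γ ^ 3‖ := by
  have hivt := intermediate_value_Icc (a := (0.496 : ℝ)) (b := 0.497) (by norm_num)
    (f := fun r : ℝ => r ^ 6 + 4 * r ^ 2 - 1) (by fun_prop)
  obtain ⟨r, ⟨hr1, hr2⟩, hr⟩ := hivt (show (0 : ℝ) ∈ _ by constructor <;> norm_num)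
  simp only at hr
  have hr0 : (0 : ℝ) < r := by linarith
  obtain ⟨t, ht⟩ : ∃ t : ℝ, t = r⁻¹ := ⟨_, rfl⟩
  have hrt : r * t = 1 := by rw [ht]; exact mul_inv_cancel₀ hr0.ne'
  have ht1 : 2.012 < t := by nlinarith
  have hv0 : 0 ≤ r ^ 2 / 4 + t / 2 := by positivity
  obtain ⟨v, hv⟩ : ∃ v : ℝ, v ^ 2 = r ^ 2 / 4 + t / 2 := ⟨_, Real.sq_sqrt hv0⟩
  have hrr : r ^ 4 + 4 - t ^ 2 = 0 := by
    have : r ^ 4 + 4 - t ^ 2 = t ^ 2 * (r ^ 6 + 4 * r ^ 2 - 1) := by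
      linear_combination (-(r ^ 4 + 4) * (r * t + 1)) * hrt
    rw [this, hr, mul_zero]
  have hq : (⟨-r / 2, v⟩ : ℂ) ^ 2 = -r * ⟨-r / 2, v⟩ - ((r ^ 2 + t) / 2 : ℝ) := by
    apply Complex.ext
    · simp [pow_two]; linear_combination -hv
    · simp [pow_two]; ring
  refine ⟨⟨-r / 2, v⟩, ?_, ?_, ?_⟩
  · generalize (⟨-r / 2, v⟩ : ℂ) = g at hq
    push_cast at hq
    have hrt' : (r : ℂ) * t = 1 := by exact_mod_cast hrt
    have hrr' : (r : ℂ) ^ 4 + 4 - t ^ 2 = 0 := by exact_mod_cast hrr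
    linear_combination (g ^ 2 - r * g + ((r : ℂ) ^ 2 - t) / 2) * hq + g * hrt' - hrr' / 4
  · have : (1.06 : ℝ) ^ 2 ≤ ‖(⟨-r / 2, v⟩ : ℂ)‖ ^ 2 := by
      rw [Complex.sq_norm, Complex.normSq_mk]
      nlinarith
    exact le_of_sq_le_sq this (norm_nonneg _)
  · refine lt_of_lt_of_le ?_ (Complex.re_le_norm _)
    simp [pow_succ]
    have e : 0 < r ^ 3 := by positivity
    nlinarith

theorem beta_four_not_parry (β : ℝ) (hβ : 1 < β) (hroot : β ^ 4 - β - 1 = 0)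
    (x : ℕ → ℝ) (c : ℕ → ℤ)
    (hx0 : x 0 = 1)
    (hc : ∀ m, c (m + 1) = ⌈β * x m⌉ - 1)
    (hx : ∀ m, x (m + 1) = β * x m - c (m + 1)) :
    ¬ ∃ p : ℕ, 1 ≤ p ∧ ∃ N : ℕ, ∀ m, N ≤ m → c (m + p) = c m := by
  rintro ⟨p, hp, N, hper⟩
  obtain ⟨γ, hγ, hγn, hγ38⟩ := bf_gamma
  have hb1 : 1.220744 < β := by
    by_contra! h
    nlinarith [mul_nonneg (sub_nonneg.2 h) (sq_nonneg β), pow_le_pow_left₀ (by linarith) h 2,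
      pow_le_pow_left₀ (by linarith) h 3]
  have hb2 : β < 1.220745 := by
    by_contra! h
    have h3 := pow_le_pow_left₀ (by norm_num) h 3
    nlinarith [h3]
  have hb4 : β ^ 4 = β + 1 := by linarith
  have hs1 : 1.49021 < β ^ 2 := by nlinarith
  have hs2 : β ^ 2 < 1.49022 := by nlinarith
  have hc1 : 1.81917 < β ^ 3 := by nlinarith
  have hc2 : β ^ 3 < 1.81919 := by nlinarith
  -- bounds
  have hxb : ∀ m, 0 < x m ∧ x m ≤ 1 := by
    intro m
    cases m with
    | zero => rw [hx0]; norm_num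
    | succ m =>
      rw [hx, hc]; push_cast
      constructor <;> linarith [Int.ceil_lt_add_one (β * x m), Int.le_ceil (β * x m)]
  have hcu : ∀ m (e : ℤ), 0 < β * x m - e → β * x m - e ≤ 1 → c (m + 1) = e := by
    intro m e h1 h2
    rw [hc]
    have : ⌈β * x m⌉ = e + 1 := by
      rw [Int.ceil_eq_iff]; push_cast; constructor <;> linarith
    omega
  have hcb : ∀ m, |(c (m + 1) : ℝ)| ≤ 1 := by
    intro m
    obtain ⟨h1, h2⟩ := hxb m
    have h3 : 0 < β * x m := by positivity
    rcases le_or_gt (β * x m) 1 with h | h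
    · rw [hcu m 0 (by simpa using h3) (by simpa using h)]; simp
    · rw [hcu m 1 (by simpa using h) (by push_cast; nlinarith)]; simp
  -- the polynomials
  let P : ℕ → Polynomial ℤ := fun m =>
    Nat.rec 1 (fun m q => Polynomial.X * q - Polynomial.C (c (m + 1))) m
  have hP0 : P 0 = 1 := rfl
  have hPs : ∀ m, P (m + 1) = Polynomial.X * P m - Polynomial.C (c (m + 1)) := fun _ => rfl
  have hPx : ∀ m, Polynomial.aeval β (P m) = x m := by
    intro m
    induction m with
    | zero => simp [hP0, hx0]
    | succ m ih => rw [hPs, hx, map_sub, map_mul, ih]; simp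
  obtain ⟨y, hy⟩ : ∃ y : ℕ → ℂ, ∀ m, Polynomial.aeval γ (P m) = y m := ⟨_, fun _ => rfl⟩
  have hy0 : y 0 = 1 := by rw [← hy, hP0]; simp
  have hys : ∀ m, y (m + 1) = γ * y m - c (m + 1) := by
    intro m; rw [← hy, ← hy, hPs, map_sub, map_mul]; simp
  have hxy : ∀ m n, x m = x n → y m = y n := by
    intro m n h
    have := bf_conj β hroot γ hγ (P m - P n) (by rw [map_sub, hPx, hPx, h, sub_self])
    rw [map_sub, hy, hy] at this
    exact sub_eq_zero.1 this
  clear_value P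
  -- runs of zeros
  have hrun : ∀ m k, β ^ k * x m ≤ 1 → x (m + k) = β ^ k * x m ∧ y (m + k) = γ ^ k * y m := by
    intro m k
    induction k with
    | zero => intro _; simp
    | succ k ih =>
      intro h
      have hpos := (hxb m).1
      have h1 : β ^ k * x m ≤ 1 := by
        refine le_trans ?_ h
        have : β ^ k ≤ β ^ (k + 1) := pow_le_pow_right₀ hβ.le (by omega)
        gcongr
      obtain ⟨i1, i2⟩ := ih h1
      have h3 : c (m + k + 1) = 0 := by
        apply hcu <;> rw [i1]
        · have : 0 < β * (β ^ k * x m) := by positivity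
          simpa using this
        · calc _ = β ^ (k + 1) * x m := by push_cast; ring
            _ ≤ 1 := h
      rw [← add_assoc, hx, hys, h3, i1, i2]
      constructor <;> push_cast <;> ring
  have hone : ∀ m, 1 < β * x m → x (m + 1) = β * x m - 1 ∧ y (m + 1) = γ * y m - 1 := by
    intro m h
    have h3 : c (m + 1) = 1 := by
      apply hcu
      · simpa using h
      · push_cast; nlinarith [(hxb m).2]
    rw [hx, hys, h3]; simp
  have r7 : ∀ {R : Type} [CommRing R] (z : R), z ^ 4 = z + 1 →
      z ^ 7 * (-1 + z) = z + z ^ 2 - z ^ 3 := by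
    intro R _ z h; grind
  have r12 : ∀ {R : Type} [CommRing R] (z : R), z ^ 4 = z + 1 →
      z ^ 12 * (-2 - z + z ^ 2 + z ^ 3) = 3 + 2 * z - 3 * z ^ 2 := by
    intro R _ z h; grind
  have r8 : ∀ {R : Type} [CommRing R] (z : R), z ^ 4 = z + 1 →
      z ^ 8 * (-1 + 3 * z + 2 * z ^ 2 - 3 * z ^ 3) = -5 - 6 * z + 4 * z ^ 2 + 4 * z ^ 3 := by
    intro R _ z h; grind
  have r7b : ∀ {R : Type} [CommRing R] (z : R), z ^ 4 = z + 1 →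
      z ^ 7 * (3 - z - 6 * z ^ 2 + 4 * z ^ 3) = 6 - z - 9 * z ^ 2 + 5 * z ^ 3 := by
    intro R _ z h; grind
  obtain ⟨x1, y1⟩ := hone 0 (by rw [hx0]; linarith)
  replace x1 : x 1 = -1 + β := by rw [x1, hx0]; ring
  replace y1 : y 1 = -1 + γ := by rw [y1, hy0]; ring
  obtain ⟨x8, y8⟩ := hrun 1 7 (by rw [x1, r7 β hb4]; linarith)
  rw [x1, r7 β hb4] at x8
  rw [y1, r7 γ hγ] at y8
  obtain ⟨x9, y9⟩ := hone 8 (by rw [x8]; linarith)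
  replace x9 : x 9 = -2 - β + β ^ 2 + β ^ 3 := by rw [x9, x8]; linear_combination -hb4
  replace y9 : y 9 = -2 - γ + γ ^ 2 + γ ^ 3 := by rw [y9, y8]; linear_combination -hγ
  obtain ⟨x21, y21⟩ := hrun 9 12 (by rw [x9, r12 β hb4]; linarith)
  rw [x9, r12 β hb4] at x21
  rw [y9, r12 γ hγ] at y21
  obtain ⟨x22, y22⟩ := hone 21 (by rw [x21]; linarith)
  replace x22 : x 22 = -1 + 3 * β + 2 * β ^ 2 - 3 * β ^ 3 := by rw [x22, x21]; ring
  replace y22 : y 22 = -1 + 3 * γ + 2 * γ ^ 2 - 3 * γ ^ 3 := by rw [y22, y21]; ring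
  obtain ⟨x30, y30⟩ := hrun 22 8 (by rw [x22, r8 β hb4]; linarith)
  rw [x22, r8 β hb4] at x30
  rw [y22, r8 γ hγ] at y30
  obtain ⟨x31, y31⟩ := hone 30 (by rw [x30]; linarith)
  replace x31 : x 31 = 3 - β - 6 * β ^ 2 + 4 * β ^ 3 := by
    rw [x31, x30]; linear_combination 4 * hb4
  replace y31 : y 31 = 3 - γ - 6 * γ ^ 2 + 4 * γ ^ 3 := by
    rw [y31, y30]; linear_combination 4 * hγ
  obtain ⟨x38, y38⟩ := hrun 31 7 (by rw [x31, r7b β hb4]; linarith)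
  rw [y31, r7b γ hγ] at y38
  rw [← y38] at hγ38
  norm_num at hγ38
  -- growth
  have hgrow : ∀ m, 18 < ‖y m‖ → ‖y m‖ < ‖y (m + 1)‖ := by
    intro m h
    have h1 : ‖γ * y m‖ - ‖(c (m + 1) : ℂ)‖ ≤ ‖y (m + 1)‖ := by
      rw [hys]; exact norm_sub_norm_le _ _
    have h2 : ‖(c (m + 1) : ℂ)‖ ≤ 1 := by
      rw [Complex.norm_intCast]; exact hcb m
    rw [norm_mul] at h1
    nlinarith
  have hbig : ∀ k, 18 < ‖y (38 + k)‖ := by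
    intro k
    induction k with
    | zero => exact hγ38
    | succ k ih => exact ih.trans (hgrow _ ih)
  have hmono : StrictMono (fun k => ‖y (38 + k)‖) :=
    strictMono_nat_of_lt_succ fun k => hgrow _ (hbig k)
  -- periodicity
  have hD : ∀ k, x (N + k + p) - x (N + k) = β ^ k * (x (N + p) - x N) := by
    intro k
    induction k with
    | zero => simp
    | succ k ih =>
      have h1 := hx (N + k + p)
      have h2 := hx (N + k)
      have h3 := hper (N + k + 1) (by omega)
      rw [show N + k + 1 + p = N + k + p + 1 by ring] at h3
      rw [show N + (k + 1) + p = N + k + p + 1 by ring, ← add_assoc, h1, h2, h3, pow_succ]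
      linear_combination β * ih
  have hD0 : x (N + p) - x N = 0 := by
    by_contra hne
    have hpos : 0 < |x (N + p) - x N| := abs_pos.2 hne
    obtain ⟨k, hk⟩ := pow_unbounded_of_one_lt (1 / |x (N + p) - x N|) hβ
    rw [div_lt_iff₀ hpos] at hk
    have h1 : |x (N + k + p) - x (N + k)| ≤ 1 := by
      rw [abs_le]
      constructor <;> linarith [(hxb (N + k + p)).1, (hxb (N + k + p)).2, (hxb (N + k)).1,
        (hxb (N + k)).2]
    rw [hD, abs_mul, abs_of_pos (by positivity)] at h1
    linarith
  have h := hD 38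
  rw [hD0, mul_zero] at h
  have h2 := hxy _ _ (sub_eq_zero.1 h)
  have h3 := hmono (show N < N + p by omega)
  simp only at h3
  rw [show N + 38 + p = 38 + (N + p) by ring, show N + 38 = 38 + N by ring] at h2
  rw [h2] at h3
  exact lt_irrefl _ h3
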